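/- Suppose I(C) is generated by the five Case 1(a) binomials f1 = x1^{a1} − x3^{a13}x4^{a14}, f2 = x2^{a2} − x1^{a21}x4^{a24}, f3 = x3^{a3} − x1^{a31}x2^{a32}, f4 = x4^{a4} − x2^{a42}x3^{a43}, f5 = x1^{a21}x3^{a43} − x2^{a32}x4^{a14}, where n1 < n2 < n3 < n4 and a2 ≤ a21 + a24. Then the ideal I(C)_* of initial forms is generated by one of the following two sets: {x3^{a13}x4^{a14}, x2^{a2}, x3^{a3}, x4^{a4}, x2^{a32}x4^{a14}} or {x3^{a13}x4^{a14}, x2^{a2} − x1^{a21}x4^{a24}, x3^{a3}, x4^{a4}, x2^{a32}x4^{a14}}; in particular I(C)_* is minimally generated by five elements. -/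

import Mathlib

open MvPolynomial

/-- The initial form `f_*` of a multivariate polynomial `f`: the homogeneous
component of `f` of least degree (for `f = 0` this is `0`). -/
noncomputable def initialForm {k : Type*} [Field k]
    (f : MvPolynomial (Fin 4) k) : MvPolynomial (Fin 4) k :=
  homogeneousComponent (sInf {n | homogeneousComponent n f ≠ 0}) f

lemma add_lt_of_mul_eq {n l m a b c : ℕ} (hl : n < l) (hm : n < m) (ha : 0 < a) (hb : 0 < b)
    (h : n * c = l * a + m * b) : a + b < c := by
  refine lt_of_mul_lt_mul_left ?_ n.zero_le
  rw [h, mul_add]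
  exact add_lt_add (Nat.mul_lt_mul_of_pos_right hl ha) (Nat.mul_lt_mul_of_pos_right hm hb)

lemma lt_add_of_mul_eq {n l m a b c : ℕ} (hl : l < n) (hm : m < n) (ha : 0 < a) (hb : 0 < b)
    (h : n * c = l * a + m * b) : c < a + b := by
  refine lt_of_mul_lt_mul_left ?_ n.zero_le
  rw [h, mul_add]
  exact add_lt_add (Nat.mul_lt_mul_of_pos_right hl ha) (Nat.mul_lt_mul_of_pos_right hm hb)

/-- The exponent vector of the monomial `X 0 ^ p * X 1 ^ q * X 2 ^ r * X 3 ^ s`. -/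
noncomputable def expVec (p q r s : ℕ) : Fin 4 →₀ ℕ :=
  Finsupp.equivFunOnFinite.symm ![p, q, r, s]

@[simp] lemma expVec_zero (p q r s : ℕ) : expVec p q r s 0 = p := rfl

@[simp] lemma expVec_one (p q r s : ℕ) : expVec p q r s 1 = q := rfl

@[simp] lemma expVec_two (p q r s : ℕ) : expVec p q r s 2 = r := rfl

@[simp] lemma expVec_three (p q r s : ℕ) : expVec p q r s 3 = s := rfl

lemma expVec_eta (u : Fin 4 →₀ ℕ) : expVec (u 0) (u 1) (u 2) (u 3) = u := by
  ext i
  fin_cases i <;> rfl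

lemma expVec_le_iff {p q r s : ℕ} {u : Fin 4 →₀ ℕ} :
    expVec p q r s ≤ u ↔ p ≤ u 0 ∧ q ≤ u 1 ∧ r ≤ u 2 ∧ s ≤ u 3 := by
  simp [Finsupp.le_def, Fin.forall_fin_succ]

lemma expVec_eq_iff {p q r s : ℕ} {u : Fin 4 →₀ ℕ} :
    expVec p q r s = u ↔ p = u 0 ∧ q = u 1 ∧ r = u 2 ∧ s = u 3 := by
  simp [DFunLike.ext_iff, Fin.forall_fin_succ]

@[simp] lemma degree_expVec (p q r s : ℕ) : (expVec p q r s).degree = p + q + r + s := by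
  simp [Finsupp.degree_eq_sum, Fin.sum_univ_four]

lemma monomial_expVec {k : Type*} [Field k] (p q r s : ℕ) :
    monomial (expVec p q r s) (1 : k) = X 0 ^ p * X 1 ^ q * X 2 ^ r * X 3 ^ s := by
  rw [monomial_eq, Finsupp.prod_fintype _ _ (by simp)]
  simp [Fin.prod_univ_four]

/-- The weight of an exponent vector when the variables have weights `n1, n2, n3, n4`. -/
def curveWeight (n1 n2 n3 n4 : ℕ) (u : Fin 4 →₀ ℕ) : ℕ :=
  n1 * u 0 + n2 * u 1 + n3 * u 2 + n4 * u 3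

section InitialForm

variable {k : Type*} [Field k]

lemma initialForm_of_isHomogeneous {f : MvPolynomial (Fin 4) k} {n : ℕ}
    (hf : f.IsHomogeneous n) : initialForm f = f := by
  rcases eq_or_ne f 0 with rfl | h0
  · simp [initialForm]
  have hset : {m | homogeneousComponent m f ≠ 0} = {n} := by
    ext m
    rw [Set.mem_ofPred_eq, homogeneousComponent_of_mem hf]
    simp [h0]
  rw [initialForm, hset, csInf_singleton, homogeneousComponent_of_mem hf, if_pos rfl]

lemma initialForm_sub_of_degree_lt {u v : Fin 4 →₀ ℕ} (h : u.degree < v.degree) :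
    initialForm (monomial u (1 : k) - monomial v 1) = monomial u 1 := by
  have hcomp (m : ℕ) : homogeneousComponent m (monomial u (1 : k) - monomial v 1) =
      (if m = u.degree then monomial u 1 else 0) - if m = v.degree then monomial v 1 else 0 := by
    rw [map_sub, homogeneousComponent_of_mem (isHomogeneous_monomial _ rfl),
      homogeneousComponent_of_mem (isHomogeneous_monomial _ rfl)]
  have hself : homogeneousComponent u.degree (monomial u (1 : k) - monomial v 1) =
      monomial u 1 := by
    rw [hcomp, if_pos rfl, if_neg h.ne, sub_zero]
  have hinf : sInf {m | homogeneousComponent m (monomial u (1 : k) - monomial v 1) ≠ 0} =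
      u.degree := by
    have hmem : u.degree ∈
        {m | homogeneousComponent m (monomial u (1 : k) - monomial v 1) ≠ 0} := by
      rw [Set.mem_ofPred_eq, hself]
      simp
    refine le_antisymm (Nat.sInf_le hmem) (le_csInf ⟨_, hmem⟩ fun m hm => ?_)
    by_contra! hlt
    exact hm (by rw [hcomp, if_neg (by omega), if_neg (by omega), sub_zero])
  rw [initialForm, hinf, hself]

lemma sInf_le_degree {f : MvPolynomial (Fin 4) k} {u : Fin 4 →₀ ℕ} (hu : u ∈ f.support) :
    sInf {n | homogeneousComponent n f ≠ 0} ≤ u.degree := by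
  refine Nat.sInf_le fun h => mem_support_iff.1 hu ?_
  simpa [coeff_homogeneousComponent] using congrArg (coeff u) h

/-- If in each weight every monomial is congruent modulo `J` to a fixed one of maximal degree,
or lies in `J` when its degree is smaller, then `J` contains the initial form of each polynomial
whose coefficients sum to zero in each weight. -/
lemma initialForm_mem_of_normalForms (wt : (Fin 4 →₀ ℕ) → ℕ)
    (J : Ideal (MvPolynomial (Fin 4) k)) (f : MvPolynomial (Fin 4) k)
    (hf : ∀ d, ∑ u ∈ f.support with wt u = d, coeff u f = 0)
    (hJ : ∀ d, ∃ M : Fin 4 →₀ ℕ, ∀ u, wt u = d →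
      (u.degree = M.degree ∧ monomial u 1 - monomial M 1 ∈ J) ∨
      (u.degree < M.degree ∧ monomial u 1 ∈ J)) :
    initialForm f ∈ J := by
  classical
  have hmon (u : Fin 4 →₀ ℕ) (c : k) : monomial u c = C c * monomial u 1 := by
    rw [C_mul_monomial, mul_one]
  have hle : ∀ u ∈ f.support, sInf {n | homogeneousComponent n f ≠ 0} ≤ u.degree :=
    fun u hu => sInf_le_degree hu
  rw [initialForm]
  generalize sInf {n | homogeneousComponent n f ≠ 0} = e at hle
  rw [homogeneousComponent_apply,
    ← Finset.sum_fiberwise_of_maps_to (g := wt) fun u hu => Finset.mem_image_of_mem wt hu]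
  refine Ideal.sum_mem _ fun d _ => ?_
  obtain ⟨M, hM⟩ := hJ d
  rw [Finset.filter_filter]
  rcases lt_or_ge e M.degree with hlt | hge
  · refine Ideal.sum_mem _ fun u hu => ?_
    obtain ⟨-, hue, hud⟩ := Finset.mem_filter.1 hu
    rcases hM u hud with h | h
    · omega
    · rw [hmon]
      exact Ideal.mul_mem_left _ _ h.2
  · have hdeg : ∀ u ∈ f.support, wt u = d →
        u.degree = e ∧ monomial u 1 - monomial M 1 ∈ J := by
      intro u hu hud
      have := hle u hu
      rcases hM u hud with h | h
      · exact ⟨by omega, h.2⟩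
      · omega
    have hfilter : {u ∈ f.support | u.degree = e ∧ wt u = d} =
        {u ∈ f.support | wt u = d} :=
      Finset.filter_congr fun u hu => ⟨And.right, fun h => ⟨(hdeg u hu h).1, h⟩⟩
    have hsum : ∑ u ∈ f.support with wt u = d, monomial u (coeff u f) =
        ∑ u ∈ f.support with wt u = d, C (coeff u f) * (monomial u 1 - monomial M 1) := by
      simp only [mul_sub, Finset.sum_sub_distrib, ← map_sum, hf d, map_zero, sub_zero, ← hmon]
    rw [hfilter, hsum]
    refine Ideal.sum_mem _ fun u hu => Ideal.mul_mem_left _ _ ?_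
    obtain ⟨hu, hud⟩ := Finset.mem_filter.1 hu
    exact (hdeg u hu hud).2

end InitialForm

section Curve

variable {k : Type*} [Field k] (n1 n2 n3 n4 : ℕ)

lemma aeval_curve_monomial (u : Fin 4 →₀ ℕ) (c : k) :
    aeval (fun i : Fin 4 => (Polynomial.X : Polynomial k) ^ (![n1, n2, n3, n4] i))
      (monomial u c) = Polynomial.monomial (curveWeight n1 n2 n3 n4 u) c := by
  rw [aeval_monomial, Finsupp.prod_fintype _ _ (by simp), ← Polynomial.C_mul_X_pow_eq_monomial]
  simp [Fin.prod_univ_four, curveWeight, ← pow_mul, ← pow_add]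

lemma sum_coeff_eq_zero_of_aeval_curve {f : MvPolynomial (Fin 4) k}
    (hf : aeval (fun i : Fin 4 => (Polynomial.X : Polynomial k) ^ (![n1, n2, n3, n4] i)) f = 0)
    (d : ℕ) :
    ∑ u ∈ f.support with curveWeight n1 n2 n3 n4 u = d, coeff u f = 0 := by
  rw [f.as_sum, map_sum] at hf
  simp only [aeval_curve_monomial] at hf
  have h := congrArg (fun g => Polynomial.coeff g d) hf
  simpa [Polynomial.finsetSum_coeff, Polynomial.coeff_monomial, Finset.sum_filter] using h

lemma monomial_sub_mem_ker_iff {u v : Fin 4 →₀ ℕ} :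
    monomial u (1 : k) - monomial v 1 ∈ RingHom.ker (aeval
      (fun i : Fin 4 => (Polynomial.X : Polynomial k) ^ (![n1, n2, n3, n4] i)) :
        MvPolynomial (Fin 4) k →ₐ[k] Polynomial k) ↔
      curveWeight n1 n2 n3 n4 u = curveWeight n1 n2 n3 n4 v := by
  rw [RingHom.mem_ker, map_sub, aeval_curve_monomial, aeval_curve_monomial, sub_eq_zero,
    Polynomial.monomial_left_inj one_ne_zero]

end Curve

/-- The exponent vectors of the monomials divisible by none of the five leading monomials. -/
def IsReducedExponent (a2 a3 a4 a32 a13 a14 : ℕ) (u : Fin 4 →₀ ℕ) : Prop :=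
  u 1 < a2 ∧ u 2 < a3 ∧ u 3 < a4 ∧ (u 2 < a13 ∨ u 3 < a14) ∧ (u 1 < a32 ∨ u 3 < a14)

section Reduction

variable {n1 n2 n3 n4 a21 a31 a32 a42 a13 a43 a14 a24 a1 a2 a3 a4 : ℕ}

/-- Divisibility of the monomial with exponent vector `u` by one of the monomials occurring in
the five binomials. -/
def DvdByTerm (a21 a31 a32 a42 a13 a43 a14 a24 a1 a2 a3 a4 : ℕ) (u : Fin 4 →₀ ℕ) : Prop :=
  a1 ≤ u 0 ∨ (a13 ≤ u 2 ∧ a14 ≤ u 3) ∨ a2 ≤ u 1 ∨ (a21 ≤ u 0 ∧ a24 ≤ u 3) ∨ a3 ≤ u 2 ∨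
    (a31 ≤ u 0 ∧ a32 ≤ u 1) ∨ a4 ≤ u 3 ∨ (a42 ≤ u 1 ∧ a43 ≤ u 2) ∨
    (a21 ≤ u 0 ∧ a43 ≤ u 2) ∨ (a32 ≤ u 1 ∧ a14 ≤ u 3)

lemma dvdByTerm_of_curveWeight_eq {k : Type*} [Field k]
    (hgen : RingHom.ker (aeval
        (fun i : Fin 4 => (Polynomial.X : Polynomial k) ^ (![n1, n2, n3, n4] i)) :
          MvPolynomial (Fin 4) k →ₐ[k] Polynomial k) =
      Ideal.span {X 0 ^ a1 - X 2 ^ a13 * X 3 ^ a14,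
        X 1 ^ a2 - X 0 ^ a21 * X 3 ^ a24,
        X 2 ^ a3 - X 0 ^ a31 * X 1 ^ a32,
        X 3 ^ a4 - X 1 ^ a42 * X 2 ^ a43,
        X 0 ^ a21 * X 2 ^ a43 - X 1 ^ a32 * X 3 ^ a14})
    {u v : Fin 4 →₀ ℕ} (huv : u ≠ v)
    (hw : curveWeight n1 n2 n3 n4 u = curveWeight n1 n2 n3 n4 v) :
    DvdByTerm a21 a31 a32 a42 a13 a43 a14 a24 a1 a2 a3 a4 u := by
  classical
  set T : Set (Fin 4 →₀ ℕ) := {expVec a1 0 0 0, expVec 0 0 a13 a14, expVec 0 a2 0 0,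
    expVec a21 0 0 a24, expVec 0 0 a3 0, expVec a31 a32 0 0, expVec 0 0 0 a4,
    expVec 0 a42 a43 0, expVec a21 0 a43 0, expVec 0 a32 0 a14} with hT
  have hmem := (monomial_sub_mem_ker_iff (k := k) n1 n2 n3 n4).2 hw
  rw [hgen] at hmem
  have hle : Ideal.span {X 0 ^ a1 - X 2 ^ a13 * X 3 ^ a14,
        X 1 ^ a2 - X 0 ^ a21 * X 3 ^ a24,
        X 2 ^ a3 - X 0 ^ a31 * X 1 ^ a32,
        X 3 ^ a4 - X 1 ^ a42 * X 2 ^ a43,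
        X 0 ^ a21 * X 2 ^ a43 - X 1 ^ a32 * X 3 ^ a14} ≤
      Ideal.span ((fun s => monomial s (1 : k)) '' T) := by
    have hin : ∀ {p q r s : ℕ}, expVec p q r s ∈ T →
        (X 0 ^ p * X 1 ^ q * X 2 ^ r * X 3 ^ s : MvPolynomial (Fin 4) k) ∈
          Ideal.span ((fun s => monomial s (1 : k)) '' T) := fun h => by
      rw [← monomial_expVec]
      exact Ideal.subset_span ⟨_, h, rfl⟩
    rw [Ideal.span_le]
    rintro g (rfl | rfl | rfl | rfl | rfl)
    · simpa using sub_mem (hin (p := a1) (q := 0) (r := 0) (s := 0) (by simp [hT]))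
        (hin (p := 0) (q := 0) (r := a13) (s := a14) (by simp [hT]))
    · simpa using sub_mem (hin (p := 0) (q := a2) (r := 0) (s := 0) (by simp [hT]))
        (hin (p := a21) (q := 0) (r := 0) (s := a24) (by simp [hT]))
    · simpa using sub_mem (hin (p := 0) (q := 0) (r := a3) (s := 0) (by simp [hT]))
        (hin (p := a31) (q := a32) (r := 0) (s := 0) (by simp [hT]))
    · simpa using sub_mem (hin (p := 0) (q := 0) (r := 0) (s := a4) (by simp [hT]))
        (hin (p := 0) (q := a42) (r := a43) (s := 0) (by simp [hT]))
    · simpa using sub_mem (hin (p := a21) (q := 0) (r := a43) (s := 0) (by simp [hT]))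
        (hin (p := 0) (q := a32) (r := 0) (s := a14) (by simp [hT]))
  obtain ⟨t, ht, htu⟩ := mem_ideal_span_monomial_image.1 (hle hmem) u (by
    simp [mem_support_iff, coeff_monomial, huv.symm])
  unfold DvdByTerm
  rcases ht with rfl | rfl | rfl | rfl | rfl | rfl | rfl | rfl | rfl | rfl <;>
    simp only [expVec_le_iff] at htu <;> simp [htu]

/-- No two distinct reduced monomials without common factor have the same weight, if the first
variable does not occur in the second one. -/
lemma not_isReducedExponent_of_disjoint
    (h21 : 0 < a21) (h31 : 0 < a31) (h32 : 0 < a32) (h42 : 0 < a42)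
    (h43 : 0 < a43) (h14 : 0 < a14) (h24 : 0 < a24)
    (ha1 : a1 = a21 + a31) (ha2 : a2 = a32 + a42)
    (ha3 : a3 = a13 + a43) (ha4 : a4 = a14 + a24)
    (e1 : n1 * a1 = n3 * a13 + n4 * a14) (e2 : n2 * a2 = n1 * a21 + n4 * a24)
    (e4 : n4 * a4 = n2 * a42 + n3 * a43)
    (hK : ∀ {u v : Fin 4 →₀ ℕ}, u ≠ v →
      curveWeight n1 n2 n3 n4 u = curveWeight n1 n2 n3 n4 v →
      DvdByTerm a21 a31 a32 a42 a13 a43 a14 a24 a1 a2 a3 a4 u)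
    {u v : Fin 4 →₀ ℕ} (huv : u ≠ v)
    (hw : curveWeight n1 n2 n3 n4 u = curveWeight n1 n2 n3 n4 v)
    (hu : IsReducedExponent a2 a3 a4 a32 a13 a14 u) (hv : IsReducedExponent a2 a3 a4 a32 a13 a14 v)
    (d0 : v 0 = 0) (d1 : u 1 = 0 ∨ v 1 = 0) (d2 : u 2 = 0 ∨ v 2 = 0)
    (d3 : u 3 = 0 ∨ v 3 = 0) : False := by
  have Ku := hK huv hw
  have Kv := hK huv.symm hw.symm
  have hK' (p q r s p' q' r' s' : ℕ)
      (hne : p ≠ p' ∨ q ≠ q' ∨ r ≠ r' ∨ s ≠ s')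
      (h : n1 * p + n2 * q + n3 * r + n4 * s = n1 * p' + n2 * q' + n3 * r' + n4 * s') :=
    hK (u := expVec p q r s) (v := expVec p' q' r' s')
      (by
        rw [Ne, expVec_eq_iff]
        simp only [expVec_zero, expVec_one, expVec_two, expVec_three]
        tauto) h
  simp only [DvdByTerm, expVec_zero, expVec_one, expVec_two, expVec_three] at hK' Ku Kv
  unfold IsReducedExponent at hu hv
  unfold curveWeight at hw
  generalize u 0 = p at *
  generalize u 1 = q at *
  generalize u 2 = r at *
  generalize u 3 = s at *
  generalize v 0 = p' at *
  generalize v 1 = q' at *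
  generalize v 2 = r' at *
  generalize v 3 = s' at *
  subst d0
  obtain ⟨hq', hr'⟩ : a42 ≤ q' ∧ a43 ≤ r' := by omega
  obtain rfl : q = 0 := by omega
  obtain rfl : r = 0 := by omega
  have hp : a1 ≤ p ∨ (a21 ≤ p ∧ a24 ≤ s) := by omega
  clear Ku Kv
  obtain ⟨q'', rfl⟩ := Nat.exists_eq_add_of_le hq'
  obtain ⟨r'', rfl⟩ := Nat.exists_eq_add_of_le hr'
  by_cases hs : a24 ≤ s ∧ a21 ≤ p
  · obtain ⟨s'', rfl⟩ := Nat.exists_eq_add_of_le hs.1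
    obtain ⟨p'', rfl⟩ := Nat.exists_eq_add_of_le hs.2
    obtain ⟨j, hj⟩ := Nat.exists_eq_add_of_le (show q'' ≤ a32 by omega)
    obtain rfl : s' = 0 := by omega
    have := hK' 0 0 (a43 + r'') 0 p'' j 0 s'' (by omega) (by
      subst hj ha2
      linarith)
    omega
  · have hp1 : a1 ≤ p := by omega
    obtain ⟨p'', rfl⟩ := Nat.exists_eq_add_of_le hp1
    by_cases hs' : s' < a14
    · obtain ⟨j, hj⟩ := Nat.exists_eq_add_of_le (show r'' ≤ a13 by omega)
      have := hK' 0 q'' 0 (a24 + s') p'' 0 j s (by omega) (by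
        subst hj ha4
        linarith)
      omega
    · obtain ⟨s'', rfl⟩ := Nat.exists_eq_add_of_le (not_lt.1 hs')
      obtain ⟨j, hj⟩ := Nat.exists_eq_add_of_le (show a43 + r'' ≤ a13 by omega)
      have := hK' 0 (a42 + q'') 0 s'' p'' 0 j s (by omega) (by
        subst hj
        linarith)
      omega

lemma IsReducedExponent.eq_of_curveWeight_eq
    (h21 : 0 < a21) (h31 : 0 < a31) (h32 : 0 < a32) (h42 : 0 < a42)
    (h43 : 0 < a43) (h14 : 0 < a14) (h24 : 0 < a24)
    (ha1 : a1 = a21 + a31) (ha2 : a2 = a32 + a42)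
    (ha3 : a3 = a13 + a43) (ha4 : a4 = a14 + a24)
    (e1 : n1 * a1 = n3 * a13 + n4 * a14) (e2 : n2 * a2 = n1 * a21 + n4 * a24)
    (e4 : n4 * a4 = n2 * a42 + n3 * a43)
    (hK : ∀ {u v : Fin 4 →₀ ℕ}, u ≠ v →
      curveWeight n1 n2 n3 n4 u = curveWeight n1 n2 n3 n4 v →
      DvdByTerm a21 a31 a32 a42 a13 a43 a14 a24 a1 a2 a3 a4 u)
    {u v : Fin 4 →₀ ℕ} (hu : IsReducedExponent a2 a3 a4 a32 a13 a14 u)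
    (hv : IsReducedExponent a2 a3 a4 a32 a13 a14 v)
    (hw : curveWeight n1 n2 n3 n4 u = curveWeight n1 n2 n3 n4 v) : u = v := by
  by_contra huv
  have hmono {a b : Fin 4 →₀ ℕ} (ha : IsReducedExponent a2 a3 a4 a32 a13 a14 a) :
      IsReducedExponent a2 a3 a4 a32 a13 a14 (a - b) := by
    simp only [IsReducedExponent, Finsupp.tsub_apply] at ha ⊢
    omega
  have hne : u - v ≠ v - u := by
    intro h
    refine huv (Finsupp.ext fun i => ?_)
    have := DFunLike.congr_fun h i
    simp only [Finsupp.tsub_apply] at this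
    omega
  have hwt : curveWeight n1 n2 n3 n4 (u - v) = curveWeight n1 n2 n3 n4 (v - u) := by
    have hsub (n a b : ℕ) : n * (a - b) + n * b = n * (b - a) + n * a := by
      rw [← mul_add, ← mul_add]
      congr 1
      omega
    have s0 := hsub n1 (u 0) (v 0)
    have s1 := hsub n2 (u 1) (v 1)
    have s2 := hsub n3 (u 2) (v 2)
    have s3 := hsub n4 (u 3) (v 3)
    simp only [curveWeight, Finsupp.tsub_apply] at hw ⊢
    omega
  have hdisj (i : Fin 4) : (u - v) i = 0 ∨ (v - u) i = 0 := by
    simp only [Finsupp.tsub_apply]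
    omega
  rcases hdisj 0 with h | h
  · exact not_isReducedExponent_of_disjoint h21 h31 h32 h42 h43 h14 h24 ha1 ha2 ha3 ha4 e1 e2 e4 hK
      hne.symm hwt.symm (hmono hv) (hmono hu) h (hdisj 1).symm (hdisj 2).symm (hdisj 3).symm
  · exact not_isReducedExponent_of_disjoint h21 h31 h32 h42 h43 h14 h24 ha1 ha2 ha3 ha4 e1 e2 e4 hK
      hne hwt (hmono hu) (hmono hv) h (hdisj 1) (hdisj 2) (hdisj 3)

/-- Rewriting with the binomials brings each monomial to a reduced one of the same weight and of
at least the same degree. -/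
lemma exists_isReducedExponent {k : Type*} [Field k] {J : Ideal (MvPolynomial (Fin 4) k)}
    (hn1 : 0 < n1) (hn2 : 0 < n2) (hn3 : 0 < n3) (hn4 : 0 < n4)
    (h21 : 0 < a21) (h31 : 0 < a31)
    (e1 : n1 * a1 = n3 * a13 + n4 * a14) (e2 : n2 * a2 = n1 * a21 + n4 * a24)
    (e3 : n3 * a3 = n1 * a31 + n2 * a32) (e4 : n4 * a4 = n2 * a42 + n3 * a43)
    (e5 : n1 * a21 + n3 * a43 = n2 * a32 + n4 * a14)
    (l1 : a13 + a14 < a1) (l2 : a2 ≤ a21 + a24) (l3 : a3 < a31 + a32) (l4 : a4 < a42 + a43)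
    (l5 : a32 + a14 < a21 + a43)
    (m1 : X 2 ^ a13 * X 3 ^ a14 ∈ J)
    (m2 : a2 = a21 + a24 ∧ X 1 ^ a2 - X 0 ^ a21 * X 3 ^ a24 ∈ J ∨
      a2 < a21 + a24 ∧ X 1 ^ a2 ∈ J)
    (m3 : X 2 ^ a3 ∈ J) (m4 : X 3 ^ a4 ∈ J) (m5 : X 1 ^ a32 * X 3 ^ a14 ∈ J)
    (u : Fin 4 →₀ ℕ) :
    ∃ M, IsReducedExponent a2 a3 a4 a32 a13 a14 M ∧
      curveWeight n1 n2 n3 n4 u = curveWeight n1 n2 n3 n4 M ∧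
      ((u.degree = M.degree ∧ monomial u 1 - monomial M 1 ∈ J) ∨
        (u.degree < M.degree ∧ monomial u 1 ∈ J)) := by
  have hbound (v : Fin 4 →₀ ℕ) : v.degree + v 0 ≤ 2 * curveWeight n1 n2 n3 n4 v := by
    rw [← expVec_eta v]
    simp only [degree_expVec, curveWeight, expVec_zero, expVec_one, expVec_two, expVec_three]
    have := Nat.le_mul_of_pos_left (v 0) hn1
    have := Nat.le_mul_of_pos_left (v 1) hn2
    have := Nat.le_mul_of_pos_left (v 2) hn3
    have := Nat.le_mul_of_pos_left (v 3) hn4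
    omega
  induction hm : 2 * curveWeight n1 n2 n3 n4 u - (u.degree + u 0) using Nat.strong_induction_on
    generalizing u with
  | _ m ih =>
    have step (v : Fin 4 →₀ ℕ) (hwt : curveWeight n1 n2 n3 n4 u = curveWeight n1 n2 n3 n4 v)
        (hdec : u.degree + u 0 < v.degree + v 0)
        (hJ : (u.degree = v.degree ∧ monomial u 1 - monomial v 1 ∈ J) ∨
          (u.degree < v.degree ∧ monomial u 1 ∈ J)) :
        ∃ M, IsReducedExponent a2 a3 a4 a32 a13 a14 M ∧
          curveWeight n1 n2 n3 n4 u = curveWeight n1 n2 n3 n4 M ∧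
          ((u.degree = M.degree ∧ monomial u 1 - monomial M 1 ∈ J) ∨
            (u.degree < M.degree ∧ monomial u 1 ∈ J)) := by
      have := hbound v
      obtain ⟨M, hM, hMw, hMJ⟩ := ih _ (by omega) v rfl
      refine ⟨M, hM, hwt.trans hMw, ?_⟩
      rcases hJ with ⟨hd, hJ⟩ | ⟨hd, hJ⟩ <;> rcases hMJ with ⟨hd', hJ'⟩ | ⟨hd', hJ'⟩
      · exact .inl ⟨hd.trans hd', by simpa using add_mem hJ hJ'⟩
      · exact .inr ⟨by omega, by simpa using add_mem hJ hJ'⟩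
      · exact .inr ⟨by omega, hJ⟩
      · exact .inr ⟨by omega, hJ⟩
    by_cases hred : IsReducedExponent a2 a3 a4 a32 a13 a14 u
    · exact ⟨u, hred, rfl, .inl ⟨rfl, by simp⟩⟩
    obtain ⟨p, q, r, s, rfl⟩ : ∃ p q r s, u = expVec p q r s := ⟨_, _, _, _, (expVec_eta u).symm⟩
    simp only [IsReducedExponent, expVec_one, expVec_two, expVec_three] at hred
    have hcases : (a13 ≤ r ∧ a14 ≤ s) ∨ a2 ≤ q ∨ a3 ≤ r ∨ a4 ≤ s ∨ (a32 ≤ q ∧ a14 ≤ s) := by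
      omega
    rcases hcases with ⟨h, h'⟩ | h | h | h | ⟨h, h'⟩
    · obtain ⟨r, rfl⟩ := Nat.exists_eq_add_of_le h
      obtain ⟨s, rfl⟩ := Nat.exists_eq_add_of_le h'
      refine step (expVec (a1 + p) q r s) ?_ ?_ (.inr ⟨?_, ?_⟩) <;>
        simp only [curveWeight, degree_expVec, monomial_expVec, expVec_zero, expVec_one, expVec_two,
          expVec_three]
      · linarith
      · omega
      · omega
      · convert J.mul_mem_left (X 0 ^ p * X 1 ^ q * X 2 ^ r * X 3 ^ s) m1 using 1
        ring
    · obtain ⟨q, rfl⟩ := Nat.exists_eq_add_of_le h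
      refine step (expVec (a21 + p) q r (a24 + s)) ?_ ?_ (m2.imp ?_ ?_) <;>
        simp only [curveWeight, degree_expVec, monomial_expVec, expVec_zero, expVec_one, expVec_two,
          expVec_three]
      · linarith
      · omega
      · refine fun ⟨hd, hJ⟩ => ⟨by omega, ?_⟩
        convert J.mul_mem_left (X 0 ^ p * X 1 ^ q * X 2 ^ r * X 3 ^ s) hJ using 1
        ring
      · refine fun ⟨hd, hJ⟩ => ⟨by omega, ?_⟩
        convert J.mul_mem_left (X 0 ^ p * X 1 ^ q * X 2 ^ r * X 3 ^ s) hJ using 1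
        ring
    · obtain ⟨r, rfl⟩ := Nat.exists_eq_add_of_le h
      refine step (expVec (a31 + p) (a32 + q) r s) ?_ ?_ (.inr ⟨?_, ?_⟩) <;>
        simp only [curveWeight, degree_expVec, monomial_expVec, expVec_zero, expVec_one, expVec_two,
          expVec_three]
      · linarith
      · omega
      · omega
      · convert J.mul_mem_left (X 0 ^ p * X 1 ^ q * X 2 ^ r * X 3 ^ s) m3 using 1
        ring
    · obtain ⟨s, rfl⟩ := Nat.exists_eq_add_of_le h
      refine step (expVec p (a42 + q) (a43 + r) s) ?_ ?_ (.inr ⟨?_, ?_⟩) <;>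
        simp only [curveWeight, degree_expVec, monomial_expVec, expVec_zero, expVec_one, expVec_two,
          expVec_three]
      · linarith
      · omega
      · omega
      · convert J.mul_mem_left (X 0 ^ p * X 1 ^ q * X 2 ^ r * X 3 ^ s) m4 using 1
        ring
    · obtain ⟨q, rfl⟩ := Nat.exists_eq_add_of_le h
      obtain ⟨s, rfl⟩ := Nat.exists_eq_add_of_le h'
      refine step (expVec (a21 + p) q (a43 + r) s) ?_ ?_ (.inr ⟨?_, ?_⟩) <;>
        simp only [curveWeight, degree_expVec, monomial_expVec, expVec_zero, expVec_one, expVec_two,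
          expVec_three]
      · linarith
      · omega
      · omega
      · convert J.mul_mem_left (X 0 ^ p * X 1 ^ q * X 2 ^ r * X 3 ^ s) m5 using 1
        ring

end Reduction

/-- If no proper divisor of the monomials `X ^ l i` occurs in an element of `J`, and `J` contains
polynomials whose coefficients at these monomials form the standard basis vectors, then `J` has no
generating set with fewer elements than there are monomials. -/
lemma card_le_card_of_span_eq {k σ : Type*} [Field k] {m : ℕ} (l : Fin m → σ →₀ ℕ)
    {J : Ideal (MvPolynomial σ k)}
    (hJ : ∀ g ∈ J, ∀ i, ∀ b, b ≤ l i → coeff b g ≠ 0 → b = l i)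
    (hb : ∀ i, ∃ g ∈ J, ∀ j, coeff (l j) g = if j = i then 1 else 0)
    (S : Finset (MvPolynomial σ k)) (hS : Ideal.span (S : Set (MvPolynomial σ k)) = J) :
    m ≤ S.card := by
  classical
  set φ : MvPolynomial σ k → Fin m → k := fun g i => coeff (l i) g with hφ
  have hmul (r g : MvPolynomial σ k) (hg : g ∈ J) : φ (r * g) = coeff 0 r • φ g := by
    funext i
    simp only [hφ, Pi.smul_apply, smul_eq_mul]
    rw [coeff_mul, Finset.sum_eq_single (0, l i)]
    · rintro ⟨a, b⟩ hab hne
      rw [Finset.HasAntidiagonal.mem_antidiagonal] at hab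
      by_contra h0
      have hbi := hJ g hg i b (hab ▸ le_add_self) (right_ne_zero_of_mul h0)
      subst hbi
      exact hne (by simpa using hab)
    · simp
  have hspan : Submodule.span k ((S.image φ : Finset (Fin m → k)) : Set (Fin m → k)) = ⊤ := by
    rw [eq_top_iff, ← (Pi.basisFun k (Fin m)).span_eq, Submodule.span_le]
    rintro _ ⟨i, rfl⟩
    obtain ⟨g, hg, hgi⟩ := hb i
    have hφg : φ g = Pi.basisFun k (Fin m) i := by
      funext j
      simp [hφ, hgi, Pi.single_apply]
    rw [← hφg, SetLike.mem_coe]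
    rw [← hS] at hg
    obtain ⟨c, -, rfl⟩ := Submodule.mem_span_finset.1 hg
    have hsum : φ (∑ a ∈ S, c a • a) = ∑ a ∈ S, coeff 0 (c a) • φ a := by
      rw [← Finset.sum_congr rfl fun a ha => hmul (c a) a (hS ▸ Ideal.subset_span ha)]
      funext i
      simp [hφ, coeff_sum]
    rw [hsum]
    refine Submodule.sum_mem _ fun a ha => Submodule.smul_mem _ _ (Submodule.subset_span ?_)
    simpa using ⟨a, ha, rfl⟩
  have hcard := finrank_span_finset_le_card (R := k) (S.image φ)
  rw [Set.finrank, hspan, finrank_top, Module.finrank_fin_fun] at hcard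
  exact hcard.trans Finset.card_image_le

lemma five_le_card_of_span_eq {k : Type*} [Field k] {a21 a24 a2 a3 a4 a32 a13 a14 : ℕ}
    {g : MvPolynomial (Fin 4) k}
    (h21 : 0 < a21) (h32 : 0 < a32) (h13 : 0 < a13) (h14 : 0 < a14)
    (h2 : a32 < a2) (h3 : a13 < a3) (h4 : a14 < a4)
    (hg : g = X 1 ^ a2 ∨ g = X 1 ^ a2 - X 0 ^ a21 * X 3 ^ a24)
    (S : Finset (MvPolynomial (Fin 4) k))
    (hS : Ideal.span (S : Set (MvPolynomial (Fin 4) k)) =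
      Ideal.span {X 2 ^ a13 * X 3 ^ a14, g, X 2 ^ a3, X 3 ^ a4, X 1 ^ a32 * X 3 ^ a14}) :
    5 ≤ S.card := by
  classical
  set T : Set (Fin 4 →₀ ℕ) := {expVec 0 0 a13 a14, expVec 0 a2 0 0, expVec 0 0 a3 0,
    expVec 0 0 0 a4, expVec 0 a32 0 a14, expVec a21 0 0 a24} with hT
  have hle : Ideal.span {X 2 ^ a13 * X 3 ^ a14, g, X 2 ^ a3, X 3 ^ a4, X 1 ^ a32 * X 3 ^ a14} ≤
      Ideal.span ((fun s => monomial s (1 : k)) '' T) := by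
    have hin : ∀ {p q r s : ℕ}, expVec p q r s ∈ T →
        (X 0 ^ p * X 1 ^ q * X 2 ^ r * X 3 ^ s : MvPolynomial (Fin 4) k) ∈
          Ideal.span ((fun s => monomial s (1 : k)) '' T) := fun h => by
      rw [← monomial_expVec]
      exact Ideal.subset_span ⟨_, h, rfl⟩
    have hin2 := hin (p := 0) (q := a2) (r := 0) (s := 0) (by simp [hT])
    rw [Ideal.span_le]
    rintro _ (rfl | rfl | rfl | rfl | rfl)
    · simpa using hin (p := 0) (q := 0) (r := a13) (s := a14) (by simp [hT])
    · rcases hg with rfl | rfl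
      · simpa using hin2
      · simpa using sub_mem hin2 (hin (p := a21) (q := 0) (r := 0) (s := a24) (by simp [hT]))
    · simpa using hin (p := 0) (q := 0) (r := a3) (s := 0) (by simp [hT])
    · simpa using hin (p := 0) (q := 0) (r := 0) (s := a4) (by simp [hT])
    · simpa using hin (p := 0) (q := a32) (r := 0) (s := a14) (by simp [hT])
  refine card_le_card_of_span_eq ![expVec 0 0 a13 a14, expVec 0 a2 0 0, expVec 0 0 a3 0,
    expVec 0 0 0 a4, expVec 0 a32 0 a14] (fun f hf i b hb hbf => ?_) (fun i => ?_) S hS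
  · obtain ⟨t, ht, htb⟩ :=
      mem_ideal_span_monomial_image.1 (hle hf) b (mem_support_iff.2 hbf)
    rw [← expVec_eta b] at hb ⊢
    rcases ht with rfl | rfl | rfl | rfl | rfl | rfl <;> rw [expVec_le_iff] at htb <;>
      fin_cases i <;>
      simp [expVec_le_iff, expVec_eq_iff] at hb ⊢ <;> omega
  · have hX (p q r s j) : (coeff j (X 0 ^ p * X 1 ^ q * X 2 ^ r * X 3 ^ s) : k) =
        if expVec p q r s = j then 1 else 0 := by
      rw [← monomial_expVec, coeff_monomial]
    fin_cases i
    · refine ⟨X 2 ^ a13 * X 3 ^ a14, Ideal.subset_span (by simp), fun j => ?_⟩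
      have := hX 0 0 a13 a14
      simp only [pow_zero, one_mul, mul_one] at this
      rw [this]
      fin_cases j <;> simp [expVec_eq_iff] <;> omega
    · refine ⟨g, Ideal.subset_span (by simp), fun j => ?_⟩
      have h := hX 0 a2 0 0
      have h' := hX a21 0 0 a24
      simp only [pow_zero, one_mul, mul_one] at h h'
      rcases hg with rfl | rfl
      · rw [h]
        fin_cases j <;> simp [expVec_eq_iff] <;> omega
      · rw [coeff_sub, h, h']
        fin_cases j <;> simp [expVec_eq_iff, h21.ne'] <;> omega
    · refine ⟨X 2 ^ a3, Ideal.subset_span (by simp), fun j => ?_⟩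
      have := hX 0 0 a3 0
      simp only [pow_zero, one_mul, mul_one] at this
      rw [this]
      fin_cases j <;> simp [expVec_eq_iff] <;> omega
    · refine ⟨X 3 ^ a4, Ideal.subset_span (by simp), fun j => ?_⟩
      have := hX 0 0 0 a4
      simp only [pow_zero, one_mul, mul_one] at this
      rw [this]
      fin_cases j <;> simp [expVec_eq_iff] <;> omega
    · refine ⟨X 1 ^ a32 * X 3 ^ a14, Ideal.subset_span (by simp), fun j => ?_⟩
      have := hX 0 a32 0 a14
      simp only [pow_zero, one_mul, mul_one] at this
      rw [this]
      fin_cases j <;> simp [expVec_eq_iff] <;> omega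

section InitialIdeal

variable {k : Type*} [Field k]
  {n1 n2 n3 n4 a21 a31 a32 a42 a13 a43 a14 a24 a1 a2 a3 a4 : ℕ} {g : MvPolynomial (Fin 4) k}

lemma span_initialForm_le
    (hn1 : 0 < n1) (hn2 : 0 < n2) (hn3 : 0 < n3) (hn4 : 0 < n4)
    (h21 : 0 < a21) (h31 : 0 < a31) (h32 : 0 < a32) (h42 : 0 < a42)
    (h43 : 0 < a43) (h14 : 0 < a14) (h24 : 0 < a24)
    (ha1 : a1 = a21 + a31) (ha2 : a2 = a32 + a42)
    (ha3 : a3 = a13 + a43) (ha4 : a4 = a14 + a24)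
    (e1 : n1 * a1 = n3 * a13 + n4 * a14) (e2 : n2 * a2 = n1 * a21 + n4 * a24)
    (e3 : n3 * a3 = n1 * a31 + n2 * a32) (e4 : n4 * a4 = n2 * a42 + n3 * a43)
    (e5 : n1 * a21 + n3 * a43 = n2 * a32 + n4 * a14)
    (l1 : a13 + a14 < a1) (l2 : a2 ≤ a21 + a24) (l3 : a3 < a31 + a32) (l4 : a4 < a42 + a43)
    (l5 : a32 + a14 < a21 + a43)
    (hK : ∀ {u v : Fin 4 →₀ ℕ}, u ≠ v →
      curveWeight n1 n2 n3 n4 u = curveWeight n1 n2 n3 n4 v →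
      DvdByTerm a21 a31 a32 a42 a13 a43 a14 a24 a1 a2 a3 a4 u)
    (hg : (a2 = a21 + a24 ∧ g = X 1 ^ a2 - X 0 ^ a21 * X 3 ^ a24) ∨
      (a2 < a21 + a24 ∧ g = X 1 ^ a2))
    {I : Ideal (MvPolynomial (Fin 4) k)}
    (hI : I = RingHom.ker (aeval
      (fun i : Fin 4 => (Polynomial.X : Polynomial k) ^ (![n1, n2, n3, n4] i)) :
        MvPolynomial (Fin 4) k →ₐ[k] Polynomial k)) :
    Ideal.span {g | ∃ f ∈ I, g = initialForm f} ≤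
      Ideal.span {X 2 ^ a13 * X 3 ^ a14, g, X 2 ^ a3, X 3 ^ a4, X 1 ^ a32 * X 3 ^ a14} := by
  subst hI
  rw [Ideal.span_le]
  rintro _ ⟨f, hf, rfl⟩
  refine initialForm_mem_of_normalForms (curveWeight n1 n2 n3 n4) _ f
    (sum_coeff_eq_zero_of_aeval_curve n1 n2 n3 n4 hf) fun d => ?_
  have hNF := exists_isReducedExponent
    (J := Ideal.span {X 2 ^ a13 * X 3 ^ a14, g, X 2 ^ a3, X 3 ^ a4, X 1 ^ a32 * X 3 ^ a14})
    hn1 hn2 hn3 hn4 h21 h31 e1 e2 e3 e4 e5 l1 l2 l3 l4 l5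
    (Ideal.subset_span (by simp))
    (hg.imp (fun h => ⟨h.1, Ideal.subset_span (by simp [h.2])⟩)
      (fun h => ⟨h.1, Ideal.subset_span (by simp [h.2])⟩))
    (Ideal.subset_span (by simp)) (Ideal.subset_span (by simp)) (Ideal.subset_span (by simp))
  by_cases hd : ∃ u, curveWeight n1 n2 n3 n4 u = d
  · obtain ⟨u₀, rfl⟩ := hd
    obtain ⟨M, hM, hMw, -⟩ := hNF u₀
    refine ⟨M, fun u hu => ?_⟩
    obtain ⟨M', hM', hMw', hMJ⟩ := hNF u
    obtain rfl : M' = M := hM'.eq_of_curveWeight_eq h21 h31 h32 h42 h43 h14 h24 ha1 ha2 ha3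
      ha4 e1 e2 e4 hK hM (by omega)
    exact hMJ
  · exact ⟨0, fun u hu => absurd ⟨u, hu⟩ hd⟩

lemma le_span_initialForm {I : Ideal (MvPolynomial (Fin 4) k)}
    (g1 : monomial (expVec a1 0 0 0) (1 : k) - monomial (expVec 0 0 a13 a14) 1 ∈ I)
    (g2 : monomial (expVec 0 a2 0 0) (1 : k) - monomial (expVec a21 0 0 a24) 1 ∈ I)
    (g3 : monomial (expVec 0 0 a3 0) (1 : k) - monomial (expVec a31 a32 0 0) 1 ∈ I)
    (g4 : monomial (expVec 0 0 0 a4) (1 : k) - monomial (expVec 0 a42 a43 0) 1 ∈ I)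
    (g5 : monomial (expVec a21 0 a43 0) (1 : k) - monomial (expVec 0 a32 0 a14) 1 ∈ I)
    (l1 : a13 + a14 < a1) (l3 : a3 < a31 + a32) (l4 : a4 < a42 + a43)
    (l5 : a32 + a14 < a21 + a43)
    (hg : (a2 = a21 + a24 ∧ g = X 1 ^ a2 - X 0 ^ a21 * X 3 ^ a24) ∨
      (a2 < a21 + a24 ∧ g = X 1 ^ a2)) :
    Ideal.span {X 2 ^ a13 * X 3 ^ a14, g, X 2 ^ a3, X 3 ^ a4, X 1 ^ a32 * X 3 ^ a14} ≤
      Ideal.span {g | ∃ f ∈ I, g = initialForm f} := by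
  rw [Ideal.span_le]
  have hin {p q r s p' q' r' s' : ℕ}
      (h : monomial (expVec p q r s) (1 : k) - monomial (expVec p' q' r' s') 1 ∈ I)
      (hd : p + q + r + s < p' + q' + r' + s') :
      X 0 ^ p * X 1 ^ q * X 2 ^ r * X 3 ^ s ∈ Ideal.span {g | ∃ f ∈ I, g = initialForm f} := by
    refine Ideal.subset_span ⟨_, h, ?_⟩
    rw [initialForm_sub_of_degree_lt (by simpa using hd), monomial_expVec]
  rintro _ (rfl | rfl | rfl | rfl | rfl)
  · simpa only [SetLike.mem_coe, pow_zero, one_mul, mul_one] using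
      hin (sub_mem_comm_iff.1 g1) (by omega)
  · rcases hg with ⟨hd, rfl⟩ | ⟨hd, rfl⟩
    · refine Ideal.subset_span ⟨_, g2, ?_⟩
      rw [initialForm_of_isHomogeneous (n := a2)]
      · simp only [monomial_expVec, pow_zero, one_mul, mul_one]
      · exact (isHomogeneous_monomial _ (by simp)).sub
          (isHomogeneous_monomial _ (by simp [hd]))
    · simpa only [SetLike.mem_coe, pow_zero, one_mul, mul_one] using hin g2 (by omega)
  · simpa only [SetLike.mem_coe, pow_zero, one_mul, mul_one] using hin g3 (by omega)
  · simpa only [SetLike.mem_coe, pow_zero, one_mul, mul_one] using hin g4 (by omega)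
  · simpa only [SetLike.mem_coe, pow_zero, one_mul, mul_one] using
      hin (sub_mem_comm_iff.1 g5) (by omega)

end InitialIdeal

theorem tangent_cone_generators_case_1a
    (k : Type*) [Field k]
    (n1 n2 n3 n4 : ℕ)
    (hn1 : 0 < n1) (hn12 : n1 < n2) (hn23 : n2 < n3) (hn34 : n3 < n4)
    (hgcd : Nat.gcd (Nat.gcd (Nat.gcd n1 n2) n3) n4 = 1)
    (a21 a31 a32 a42 a13 a43 a14 a24 a1 a2 a3 a4 : ℕ)
    (h21 : 0 < a21) (h31 : 0 < a31) (h32 : 0 < a32) (h42 : 0 < a42)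
    (h13 : 0 < a13) (h43 : 0 < a43) (h14 : 0 < a14) (h24 : 0 < a24)
    (ha1 : a1 = a21 + a31) (ha2 : a2 = a32 + a42)
    (ha3 : a3 = a13 + a43) (ha4 : a4 = a14 + a24)
    (hb21 : a21 < a1) (hb31 : a31 < a1) (hb32 : a32 < a2) (hb42 : a42 < a2)
    (hb13 : a13 < a3) (hb43 : a43 < a3) (hb14 : a14 < a4) (hb24 : a24 < a4)
    (hc : a2 ≤ a21 + a24)
    (x1 x2 x3 x4 : MvPolynomial (Fin 4) k)
    (hx1 : x1 = X 0) (hx2 : x2 = X 1) (hx3 : x3 = X 2) (hx4 : x4 = X 3)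
    (IC : Ideal (MvPolynomial (Fin 4) k))
    (hIC : IC = RingHom.ker (aeval
      (fun i : Fin 4 => (Polynomial.X : Polynomial k) ^ (![n1, n2, n3, n4] i)) :
        MvPolynomial (Fin 4) k →ₐ[k] Polynomial k))
    (hgen : IC = Ideal.span {x1 ^ a1 - x3 ^ a13 * x4 ^ a14,
      x2 ^ a2 - x1 ^ a21 * x4 ^ a24,
      x3 ^ a3 - x1 ^ a31 * x2 ^ a32,
      x4 ^ a4 - x2 ^ a42 * x3 ^ a43,
      x1 ^ a21 * x3 ^ a43 - x2 ^ a32 * x4 ^ a14})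
    (Istar : Ideal (MvPolynomial (Fin 4) k))
    (hIstar : Istar = Ideal.span {g | ∃ f ∈ IC, g = initialForm f}) :
    (Istar = Ideal.span {x3 ^ a13 * x4 ^ a14, x2 ^ a2, x3 ^ a3, x4 ^ a4,
        x2 ^ a32 * x4 ^ a14} ∨
      Istar = Ideal.span {x3 ^ a13 * x4 ^ a14, x2 ^ a2 - x1 ^ a21 * x4 ^ a24,
        x3 ^ a3, x4 ^ a4, x2 ^ a32 * x4 ^ a14}) ∧
    (∃ S : Finset (MvPolynomial (Fin 4) k), S.card = 5 ∧
      Ideal.span (S : Set (MvPolynomial (Fin 4) k)) = Istar) ∧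
    (∀ S : Finset (MvPolynomial (Fin 4) k),
      Ideal.span (S : Set (MvPolynomial (Fin 4) k)) = Istar → 5 ≤ S.card) := by
  classical
  subst hx1 hx2 hx3 hx4 hIC hIstar
  set I := RingHom.ker (aeval
      (fun i : Fin 4 => (Polynomial.X : Polynomial k) ^ (![n1, n2, n3, n4] i)) :
        MvPolynomial (Fin 4) k →ₐ[k] Polynomial k) with hI
  have hK {u v : Fin 4 →₀ ℕ} (huv : u ≠ v)
      (hw : curveWeight n1 n2 n3 n4 u = curveWeight n1 n2 n3 n4 v) :=
    dvdByTerm_of_curveWeight_eq hgen huv hw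
  have hmem (p q r s p' q' r' s' : ℕ)
      (h : monomial (expVec p q r s) (1 : k) - monomial (expVec p' q' r' s') 1 ∈ I) :
      n1 * p + n2 * q + n3 * r + n4 * s = n1 * p' + n2 * q' + n3 * r' + n4 * s' :=
    (monomial_sub_mem_ker_iff n1 n2 n3 n4).1 h
  have g1 : monomial (expVec a1 0 0 0) (1 : k) - monomial (expVec 0 0 a13 a14) 1 ∈ I := by
    rw [hgen]
    exact Ideal.subset_span (by simp [monomial_expVec])
  have g2 : monomial (expVec 0 a2 0 0) (1 : k) - monomial (expVec a21 0 0 a24) 1 ∈ I := by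
    rw [hgen]
    exact Ideal.subset_span (by simp [monomial_expVec])
  have g3 : monomial (expVec 0 0 a3 0) (1 : k) - monomial (expVec a31 a32 0 0) 1 ∈ I := by
    rw [hgen]
    exact Ideal.subset_span (by simp [monomial_expVec])
  have g4 : monomial (expVec 0 0 0 a4) (1 : k) - monomial (expVec 0 a42 a43 0) 1 ∈ I := by
    rw [hgen]
    exact Ideal.subset_span (by simp [monomial_expVec])
  have g5 : monomial (expVec a21 0 a43 0) (1 : k) - monomial (expVec 0 a32 0 a14) 1 ∈ I := by
    rw [hgen]
    exact Ideal.subset_span (by simp [monomial_expVec])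
  have e1 : n1 * a1 = n3 * a13 + n4 * a14 := by simpa using hmem _ _ _ _ _ _ _ _ g1
  have e2 : n2 * a2 = n1 * a21 + n4 * a24 := by simpa using hmem _ _ _ _ _ _ _ _ g2
  have e3 : n3 * a3 = n1 * a31 + n2 * a32 := by simpa using hmem _ _ _ _ _ _ _ _ g3
  have e4 : n4 * a4 = n2 * a42 + n3 * a43 := by simpa using hmem _ _ _ _ _ _ _ _ g4
  have e5 : n1 * a21 + n3 * a43 = n2 * a32 + n4 * a14 := by
    simpa using hmem _ _ _ _ _ _ _ _ g5
  have l1 : a13 + a14 < a1 :=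
    add_lt_of_mul_eq (hn12.trans hn23) (hn12.trans (hn23.trans hn34)) h13 h14 e1
  have l3 : a3 < a31 + a32 := lt_add_of_mul_eq (hn12.trans hn23) hn23 h31 h32 e3
  have l4 : a4 < a42 + a43 := lt_add_of_mul_eq (hn23.trans hn34) hn34 h42 h43 e4
  have l5 : a32 + a14 < a21 + a43 := by omega
  obtain ⟨g, hg⟩ : ∃ g : MvPolynomial (Fin 4) k,
      (a2 = a21 + a24 ∧ g = X 1 ^ a2 - X 0 ^ a21 * X 3 ^ a24) ∨
      (a2 < a21 + a24 ∧ g = X 1 ^ a2) := by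
    rcases hc.eq_or_lt with h | h
    · exact ⟨_, .inl ⟨h, rfl⟩⟩
    · exact ⟨_, .inr ⟨h, rfl⟩⟩
  have hspan : Ideal.span {g | ∃ f ∈ I, g = initialForm f} =
      Ideal.span {X 2 ^ a13 * X 3 ^ a14, g, X 2 ^ a3, X 3 ^ a4, X 1 ^ a32 * X 3 ^ a14} :=
    le_antisymm
      (span_initialForm_le hn1 (hn1.trans hn12) (hn1.trans (hn12.trans hn23))
        (hn1.trans (hn12.trans (hn23.trans hn34))) h21 h31 h32 h42 h43 h14 h24 ha1 ha2 ha3 ha4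
        e1 e2 e3 e4 e5 l1 hc l3 l4 l5 hK hg hI)
      (le_span_initialForm g1 g2 g3 g4 g5 l1 l3 l4 l5 hg)
  have hmin := five_le_card_of_span_eq (a21 := a21) (a24 := a24) h21 h32 h13 h14 hb32 hb13 hb14
    ((hg.imp And.right And.right).symm)
  rw [← hspan] at hmin
  refine ⟨?_, ⟨{X 2 ^ a13 * X 3 ^ a14, g, X 2 ^ a3, X 3 ^ a4, X 1 ^ a32 * X 3 ^ a14}, ?_, ?_⟩,
    hmin⟩
  · rw [hspan]
    rcases hg with ⟨-, rfl⟩ | ⟨-, rfl⟩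
    · exact .inr rfl
    · exact .inl rfl
  · exact le_antisymm Finset.card_le_five (hmin _ (by simp [hspan]))
  · simp [hspan]
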